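/- Let 0 < δ ≤ σ ≤ 1/200 and assume that R = R^δ_σ(p,v) and R' = R^δ_σ(p',v') are 100-incomparable (δ,σ)-rectangles with p, p' ∈ 𝐃. Suppose further that there exists an interval 𝐈 ⊂ ℝ such that Γ_{𝐈,p,v} ⊂ S_+(p), Γ_{𝐈,p',v'} ⊂ S_+(p'), π(R) ∪ π(R') ⊂ 𝐈, and f_{p,+} and f_{p',+} are 2-Lipschitz on 𝐈. Then, if R ∩ R' ≠ ∅, there exists a point θ ∈ π(R ∪ R') such that |f_{p,+}(θ) − f_{p',+}(θ)| > 20δ. -/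

import Mathlib

open Metric Set

noncomputable section

/-- The plane `ℝ²`. -/
abbrev Plane := EuclideanSpace ℝ (Fin 2)

/-- The parameter space `ℝ² × ℝ` of circles: a pair `(x, r)` of a centre and a radius. -/
abbrev Param := (EuclideanSpace ℝ (Fin 2)) × ℝ

/-- The point of `ℝ²` with coordinates `a`, `b`. -/
def mk2 (a b : ℝ) : Plane := (WithLp.equiv 2 (Fin 2 → ℝ)).symm ![a, b]

/-- The Euclidean distance on `ℝ² × ℝ`, viewed as `ℝ³`. -/
def pdist (p q : Param) : ℝ := Real.sqrt (dist p.1 q.1 ^ 2 + (p.2 - q.2) ^ 2)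

/-- The tangency parameter `Δ(p,q) = ||x - x'| - |r - r'||`. -/
def tang (p q : Param) : ℝ := abs (dist p.1 q.1 - |p.2 - q.2|)

/-- The domain `𝐃 = {(x,r) : |x| ≤ 1/4, r ∈ [1/2, 1]}`. -/
def domD : Set Param := {p | ‖p.1‖ ≤ 1 / 4 ∧ p.2 ∈ Set.Icc (1 / 2 : ℝ) 1}

/-- The circle `S(p)` with centre `p.1` and radius `p.2`. -/
def circ (p : Param) : Set Plane := Metric.sphere p.1 p.2

/-- The closed `δ`-annulus `S^δ(p)` around the circle `S(p)`. -/
def annulus (δ : ℝ) (p : Param) : Set Plane := {w | Metric.infDist w (circ p) ≤ δ}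

/-- The `(δ,σ)`-rectangle `R^δ_σ(p,v) = S^δ(p) ∩ B(v,σ)`. -/
def rect (δ σ : ℝ) (p : Param) (v : Plane) : Set Plane :=
  annulus δ p ∩ Metric.closedBall v σ

/-- Admissible data `(p, v)` for a rectangle: `p ∈ 𝐃` and `v ∈ S(p)`. -/
def IsRectData (r : Param × Plane) : Prop := r.1 ∈ domD ∧ r.2 ∈ circ r.1

/-- `C`-comparability of two rectangles (given by their data): there is a third
`(δ,σ)`-rectangle `R` with `R₁ ∪ R₂ ⊆ C·R`. -/
def Comp (δ σ C : ℝ) (r₁ r₂ : Param × Plane) : Prop :=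
  ∃ r : Param × Plane, IsRectData r ∧
    rect δ σ r₁.1 r₁.2 ∪ rect δ σ r₂.1 r₂.2 ⊆ rect (C * δ) (C * σ) r.1 r.2

/-- The index of the dyadic `δ`-cube of `ℝ²` containing a point. -/
def idx2 (δ : ℝ) (v : Plane) : ℤ × ℤ := (⌊v 0 / δ⌋, ⌊v 1 / δ⌋)

/-- The index of the dyadic `δ`-cube of `ℝ³ = ℝ² × ℝ` containing a point. -/
def idx3 (δ : ℝ) (p : Param) : (ℤ × ℤ) × ℤ := (idx2 δ p.1, ⌊p.2 / δ⌋)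

/-- `|E|_δ`: the number of dyadic `δ`-cubes intersecting `E ⊆ ℝ²`. -/
def count2 (δ : ℝ) (E : Set Plane) : ℕ := Nat.card (idx2 δ '' E)

/-- `|P|_δ`: the number of dyadic `δ`-cubes intersecting `P ⊆ ℝ³`. -/
def count3 (δ : ℝ) (P : Set Param) : ℕ := Nat.card (idx3 δ '' P)

/-- `|Ω|_δ`: the number of dyadic `δ`-cubes of `ℝ⁵ = ℝ³ × ℝ²` intersecting `Ω`. -/
def count5 (δ : ℝ) (Ω : Set (Param × Plane)) : ℕ :=
  Nat.card ((fun ω => (idx3 δ ω.1, idx2 δ ω.2)) '' Ω)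

/-- A `(δ,s,C)`-set in the plane. -/
def IsDSet2 (δ s C : ℝ) (E : Set Plane) : Prop :=
  Bornology.IsBounded E ∧ ∀ (x : Plane) (r : ℝ), δ ≤ r →
    (count2 δ (E ∩ Metric.closedBall x r) : ℝ) ≤ C * r ^ s * (count2 δ E : ℝ)

/-- A `(δ,s,C)`-set in `ℝ³ = ℝ² × ℝ`. -/
def IsDSet3 (δ s C : ℝ) (P : Set Param) : Prop :=
  Bornology.IsBounded P ∧ ∀ (x : Param) (r : ℝ), δ ≤ r →
    (count3 δ (P ∩ {q | pdist q x ≤ r}) : ℝ) ≤ C * r ^ s * (count3 δ P : ℝ)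

/-- `x ∈ 2^{-ℕ}`. -/
def IsDyadic (x : ℝ) : Prop := ∃ n : ℕ, x = (2 : ℝ) ^ (-(n : ℤ))

/-- The smallest dyadic rational `2^{-n} ≥ σ` (for `σ ∈ (0,1]`). -/
def dyadicCeil (σ : ℝ) : ℝ := (2 : ℝ) ^ (-⌊Real.logb 2 σ⁻¹⌋)

/-- Indices of dyadic cubes in `ℝ³ = ℝ² × ℝ`. -/
abbrev CubeIdx := (ℤ × ℤ) × ℤ

/-- The dyadic cube of side length `δ` with index `k`. -/
def cubeSet (δ : ℝ) (k : CubeIdx) : Set Param :=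
  {p | (k.1.1 : ℝ) * δ ≤ p.1 0 ∧ p.1 0 < ((k.1.1 : ℝ) + 1) * δ ∧
       (k.1.2 : ℝ) * δ ≤ p.1 1 ∧ p.1 1 < ((k.1.2 : ℝ) + 1) * δ ∧
       (k.2 : ℝ) * δ ≤ p.2 ∧ p.2 < ((k.2 : ℝ) + 1) * δ}

/-- The centre of the dyadic cube of side length `δ` with index `k`. -/
def cubeCtr (δ : ℝ) (k : CubeIdx) : Param :=
  (mk2 (((k.1.1 : ℝ) + 1 / 2) * δ) (((k.1.2 : ℝ) + 1 / 2) * δ), ((k.2 : ℝ) + 1 / 2) * δ)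

/-- The unit vector with angle `θ`. -/
def dir (θ : ℝ) : Plane := mk2 (Real.cos θ) (Real.sin θ)

/-- The `j`-th (half-open) arc of the partition `𝒮_σ(p)` of the circle `S(p)`
into arcs of length `2πrσ`. -/
def arcSet (p : Param) (σ : ℝ) (j : ℤ) : Set Plane :=
  {w | ∃ θ : ℝ, (j : ℝ) * (2 * Real.pi * σ) ≤ θ ∧ θ < ((j : ℝ) + 1) * (2 * Real.pi * σ) ∧
    w = p.1 + p.2 • dir θ}

/-- The centre of the `j`-th arc of `𝒮_σ(p)`. -/
def arcCenterAt (p : Param) (σ : ℝ) (j : ℤ) : Plane :=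
  p.1 + p.2 • dir (((j : ℝ) + 1 / 2) * (2 * Real.pi * σ))

/-- Valid indices for the arcs of `𝒮_σ(p)`. -/
def validArc (σ : ℝ) (j : ℤ) : Prop := 0 ≤ j ∧ (j : ℝ) < σ⁻¹

/-- The (one-sided) cone `V(p, I)` centred at the centre of `p` and spanned by `I`. -/
def cone (p : Param) (I : Set Plane) : Set Plane :=
  {x | ∃ e ∈ I, ∃ t : ℝ, 0 ≤ t ∧ x = p.1 + t • (e - p.1)}

/-- A pair: (index of a dyadic cube in `ℝ³`, index of an arc). -/
abbrev DPair := CubeIdx × ℤ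

/-- The relation `(p,v) ≺ (𝐩,𝐯)` between pairs at scales `(δ,σ)` and `(Δ,Σ)`. -/
def prec (δ σ Δ Sg : ℝ) (ω W : DPair) : Prop :=
  cubeSet δ ω.1 ⊆ cubeSet Δ W.1 ∧
  arcCenterAt (cubeCtr δ ω.1) σ ω.2 ∈ cone (cubeCtr Δ W.1) (arcSet (cubeCtr Δ W.1) Sg W.2)

/-- The `(Δ,Σ)`-skeleton `Ω^Δ_Σ` of a set of pairs at scales `(δ,σ)`. -/
def skeleton (δ σ Δ Sg : ℝ) (Ω : Set DPair) : Set DPair :=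
  {W | cubeSet Δ W.1 ⊆ domD ∧ validArc Sg W.2 ∧ ∃ ω ∈ Ω, prec δ σ Δ Sg ω W}

/-- The cube family `P` of a configuration. -/
def configP (Ω : Set DPair) : Set CubeIdx := Prod.fst '' Ω

/-- The arc family `E_σ(p)` of a configuration. -/
def configE (Ω : Set DPair) (k : CubeIdx) : Set ℤ := {j | (k, j) ∈ Ω}

/-- A (dyadic) `(δ,σ,s,C,M)`-configuration. -/
def IsConfigD (δ σ s C : ℝ) (M : ℕ) (Ω : Set DPair) : Prop :=
  (configP Ω).Nonempty ∧
  (∀ k ∈ configP Ω, cubeSet δ k ⊆ domD) ∧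
  IsDSet3 δ s C (⋃ k ∈ configP Ω, cubeSet δ k) ∧
  ∀ k ∈ configP Ω,
    (∀ j ∈ configE Ω k, validArc σ j) ∧
    IsDSet2 σ s C (⋃ j ∈ configE Ω k, arcSet (cubeCtr δ k) σ j) ∧
    Nat.card (configE Ω k) = M

/-- The partial multiplicity function `m^{ρ_λ,ρ_t,C}_{Δ,λ,t}(ω ∣ G)`, counting pairs in the
`(Δ, σa)`-skeleton of `G`; the geometric data of `ω` is given by the circle parameter `pω`
(the centre of the cube of `ω`) and the arc centre `vω`. -/
def pMult (baseδ baseσ Δ σa lam t ρl ρt C : ℝ) (G : Set DPair) (pω : Param) (vω : Plane) : ℕ :=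
  Nat.card {ω' : DPair | ω' ∈ skeleton baseδ baseσ Δ σa G ∧
    (lam ≤ ρl * Δ ∨ lam / ρl ≤ tang pω (cubeCtr Δ ω'.1)) ∧
    tang pω (cubeCtr Δ ω'.1) ≤ ρl * lam ∧
    t / ρt ≤ pdist pω (cubeCtr Δ ω'.1) ∧
    pdist pω (cubeCtr Δ ω'.1) ≤ ρt * t ∧
    (rect (C * Δ) (C * σa) pω vω ∩
      rect (C * Δ) (C * σa) (cubeCtr Δ ω'.1) (arcCenterAt (cubeCtr Δ ω'.1) σa ω'.2)).Nonempty}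

/-- A `δ`-separated set in `ℝ³ = ℝ² × ℝ`. -/
def sep3 (δ : ℝ) (A : Set Param) : Prop := ∀ p ∈ A, ∀ q ∈ A, p ≠ q → δ ≤ pdist p q

/-- A `(δ,ε)`-almost `t`-bipartite pair. -/
def AlmostBipartite (δ ε t : ℝ) (W B : Set Param) : Prop :=
  sep3 δ W ∧ sep3 δ B ∧ (∀ p ∈ W, ∀ q ∈ B, δ ^ ε * t ≤ pdist p q) ∧
    ∀ p ∈ W ∪ B, ∀ q ∈ W ∪ B, pdist p q ≤ δ ^ (-ε) * t

/-- A `t`-bipartite pair (relative to the scale `δ`). -/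
def Bipartite (δ t : ℝ) (W B : Set Param) : Prop :=
  sep3 δ W ∧ sep3 δ B ∧
  (∀ p ∈ W, ∀ q ∈ W, pdist p q ≤ t) ∧ (∀ p ∈ B, ∀ q ∈ B, pdist p q ≤ t) ∧
  (∀ p ∈ B, ∀ q ∈ W, t ≤ pdist p q) ∧
  ∀ p ∈ W ∪ B, ∀ q ∈ W ∪ B, pdist p q ≤ 100 * t

/-- The function `f_{p,+}` whose graph is the upper half of the circle with centre
`(p.1 0, p.1 1)` and radius `p.2`. -/
def fplus (p : Param) (θ : ℝ) : ℝ := Real.sqrt (p.2 ^ 2 - (θ - p.1 0) ^ 2) + p.1 1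

/-- The projection `π(y₁,y₂) = y₁`. -/
def pr1 : Plane → ℝ := fun w => w 0

/-- The upper half-circle `S_+(p)`. -/
def Splus (p : Param) : Set Plane :=
  {w | ∃ θ ∈ Set.Icc (p.1 0 - p.2) (p.1 0 + p.2), w = mk2 θ (fplus p θ)}

lemma aux_A (r X Y e c : ℝ) (I : Set ℝ) (hI : I.OrdConnected)
    (he : e ∈ I) (hc : c ∈ I) (hec : c ≠ e) (her : (e - X) ^ 2 ≤ r ^ 2) (hcr : (c - X) ^ 2 ≤ r ^ 2)
    (hL : ∀ s ∈ I, ∀ t ∈ I, |(Real.sqrt (r ^ 2 - (s - X) ^ 2) + Y) -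
      (Real.sqrt (r ^ 2 - (t - X) ^ 2) + Y)| ≤ 2 * |s - t|) :
    5 * (e - X) ^ 2 ≤ 4 * r ^ 2 := by
  set g : ℝ → ℝ := fun s => Real.sqrt (r ^ 2 - (s - X) ^ 2) with hg
  have key : ∀ ε ∈ Set.Ioo (0 : ℝ) 1,
      |(e - X) + (e + ε * (c - e) - X)| ≤ 2 * (g (e + ε * (c - e)) + g e) := by
    intro ε hε
    obtain ⟨h0, h1⟩ := hε
    set z := e + ε * (c - e) with hz
    have hzI : z ∈ I := by
      have hconv : Convex ℝ I := hI.convex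
      have := hconv he hc (by linarith : 0 ≤ 1 - ε) h0.le (by ring)
      simp only [smul_eq_mul] at this
      have h2 : z = (1 - ε) * e + ε * c := by rw [hz]; ring
      rw [h2]; exact this
    have hzr : (z - X) ^ 2 ≤ r ^ 2 := by
      have h2 : z - X = (1 - ε) * (e - X) + ε * (c - X) := by rw [hz]; ring
      rw [h2]
      nlinarith [mul_nonneg (mul_nonneg h0.le (by linarith : 0 ≤ 1 - ε)) (sq_nonneg ((e - X) - (c - X))),
        mul_le_mul_of_nonneg_left her (by linarith : 0 ≤ 1 - ε),
        mul_le_mul_of_nonneg_left hcr h0.le]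
    have hne : 0 < |z - e| := by
      rw [abs_pos, hz]
      have : c - e ≠ 0 := sub_ne_zero.mpr hec
      have : ε * (c - e) ≠ 0 := mul_ne_zero h0.ne' this
      simpa using this
    have hl := hL z hzI e he
    have hl' : |g z - g e| ≤ 2 * |z - e| := by
      have : g z - g e = (Real.sqrt (r ^ 2 - (z - X) ^ 2) + Y) -
        (Real.sqrt (r ^ 2 - (e - X) ^ 2) + Y) := by simp only [hg]; ring
      rw [this]; exact hl
    have gz : g z ^ 2 = r ^ 2 - (z - X) ^ 2 := Real.sq_sqrt (by linarith)
    have ge : g e ^ 2 = r ^ 2 - (e - X) ^ 2 := Real.sq_sqrt (by linarith)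
    have gz0 : 0 ≤ g z := Real.sqrt_nonneg _
    have ge0 : 0 ≤ g e := Real.sqrt_nonneg _
    have e1 : |z - e| * |(e - X) + (z - X)| = |g z - g e| * (g z + g e) := by
      rw [← abs_of_nonneg (by linarith : 0 ≤ g z + g e), ← abs_mul, ← abs_mul, ← abs_neg]
      congr 1
      nlinarith
    have e2 : |z - e| * |(e - X) + (z - X)| ≤ |z - e| * (2 * (g z + g e)) := by
      rw [e1]
      calc _ ≤ 2 * |z - e| * (g z + g e) := mul_le_mul_of_nonneg_right hl' (by linarith)
        _ = _ := by ring
    exact le_of_mul_le_mul_left e2 hne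
  have hgc : Continuous g := by fun_prop
  have lim : |(e - X) + (e + 0 * (c - e) - X)| ≤ 2 * (g (e + 0 * (c - e)) + g e) := by
    have c1 : Continuous fun ε : ℝ => |(e - X) + (e + ε * (c - e) - X)| := by fun_prop
    have c2 : Continuous fun ε : ℝ => 2 * (g (e + ε * (c - e)) + g e) := by fun_prop
    have : Set.Ioo (0 : ℝ) 1 ∈ nhdsWithin (0 : ℝ) (Set.Ioi 0) := Ioo_mem_nhdsGT one_pos
    exact le_of_tendsto_of_tendsto ((c1.tendsto 0).mono_left nhdsWithin_le_nhds)
      ((c2.tendsto 0).mono_left nhdsWithin_le_nhds) (Filter.mem_of_superset this key)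
  have ge : g e ^ 2 = r ^ 2 - (e - X) ^ 2 := Real.sq_sqrt (by linarith)
  have ge0 : 0 ≤ g e := Real.sqrt_nonneg _
  have h3 : |e - X| ≤ 2 * g e := by
    have : (e - X) + (e + 0 * (c - e) - X) = 2 * (e - X) := by ring
    rw [this, abs_mul] at lim
    simp at lim
    linarith
  have := sq_abs (e - X)
  nlinarith [abs_nonneg (e - X)]

lemma aux_B (r X Y s δ : ℝ) (hr : 1 / 2 ≤ r) (hδ : 0 < δ) (hδ' : δ ≤ 1 / 200)
    (I : Set ℝ) (hI : I.OrdConnected)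
    (hs1 : s - δ ∈ I) (hs2 : s + δ ∈ I) (hsr : (s - X) ^ 2 ≤ r ^ 2)
    (hL : ∀ s ∈ I, ∀ t ∈ I, |(Real.sqrt (r ^ 2 - (s - X) ^ 2) + Y) -
      (Real.sqrt (r ^ 2 - (t - X) ^ 2) + Y)| ≤ 2 * |s - t|) :
    ∀ t ∈ I, 5 * (t - X) ^ 2 ≤ 4 * r ^ 2 := by
  have hsI : s ∈ I := hI.out hs1 hs2 ⟨by linarith, by linarith⟩
  obtain ⟨hsl, hsu⟩ := abs_le_of_sq_le_sq' hsr (by linarith)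
  have hB : ∀ t ∈ I, (t - X) ^ 2 ≤ r ^ 2 := by
    intro t ht
    apply sq_le_sq'
    · by_contra! h
      have hrI : X - r ∈ I := hI.out ht hsI ⟨by linarith, by linarith⟩
      by_cases hse : s = X - r
      · have := aux_A r X Y (X - r) (s + δ) I hI hrI hs2 (by rw [hse]; linarith) (by nlinarith)
          (by rw [hse]; nlinarith) hL
        nlinarith
      · have := aux_A r X Y (X - r) s I hI hrI hsI hse (by nlinarith) hsr hL
        nlinarith
    · by_contra! h
      have hrI : X + r ∈ I := hI.out hsI ht ⟨by linarith, by linarith⟩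
      by_cases hse : s = X + r
      · have := aux_A r X Y (X + r) (s - δ) I hI hrI hs1 (by rw [hse]; linarith) (by nlinarith)
          (by rw [hse]; nlinarith) hL
        nlinarith
      · have := aux_A r X Y (X + r) s I hI hrI hsI hse (by nlinarith) hsr hL
        nlinarith
  intro t ht
  by_cases h : s = t
  · exact aux_A r X Y t (s + δ) I hI ht hs2 (by rw [h]; linarith) (hB t ht) (hB _ hs2) hL
  · exact aux_A r X Y t s I hI ht hsI h (hB t ht) hsr hL

lemma mk2_zero (a b : ℝ) : (mk2 a b) 0 = a := rfl
lemma mk2_one (a b : ℝ) : (mk2 a b) 1 = b := rfl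

lemma dist_sq2 (a b : Plane) : dist a b ^ 2 = (a 0 - b 0) ^ 2 + (a 1 - b 1) ^ 2 := by
  rw [EuclideanSpace.dist_eq, Real.sq_sqrt (by positivity), Fin.sum_univ_two]
  simp [Real.dist_eq, sq_abs]

lemma shift_mem (δ σ τ : ℝ) (hδ : 0 < δ) (hδσ : δ ≤ σ) (hτ : |τ| ≤ δ) (p : Param) (v : Plane)
    (hv : v ∈ circ p) : v 0 + τ ∈ pr1 '' rect δ σ p v := by
  have hd : dist (mk2 (v 0 + τ) (v 1)) v ≤ δ := by
    apply abs_le_of_sq_le_sq _ hδ.le |> le_trans (le_abs_self _)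
    rw [dist_sq2, mk2_zero, mk2_one]
    have := sq_le_sq' (by linarith [abs_nonneg τ]) hτ
    rw [sq_abs] at this
    nlinarith
  exact ⟨mk2 (v 0 + τ) (v 1), ⟨(Metric.infDist_le_dist_of_mem hv).trans hd,
    Metric.mem_closedBall.mpr (hd.trans hδσ)⟩, rfl⟩

lemma slope_bd (δ σ : ℝ) (hδ : 0 < δ) (hδσ : δ ≤ σ) (hσ : σ ≤ 1 / 200) (p : Param) (hp : p ∈ domD)
    (v : Plane) (hv : v ∈ circ p) (I : Set ℝ) (hI : I.OrdConnected)
    (hR : pr1 '' rect δ σ p v ⊆ I) (hL : LipschitzOnWith 2 (fplus p) I) :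
    ∀ t ∈ I, 5 * (t - p.1 0) ^ 2 ≤ 4 * p.2 ^ 2 := by
  have hr := hp.2.1
  apply aux_B p.2 (p.1 0) (p.1 1) (v 0) δ hr hδ (by linarith) I hI
  · have := shift_mem δ σ (-δ) hδ hδσ (by rw [abs_neg, abs_of_pos hδ]) p v hv
    exact hR (by simpa [sub_eq_add_neg] using this)
  · exact hR (shift_mem δ σ δ hδ hδσ (by rw [abs_of_pos hδ]) p v hv)
  · have h1 : dist v p.1 = p.2 := hv
    have := dist_sq2 v p.1
    rw [h1] at this
    nlinarith [sq_nonneg (v 1 - p.1 1)]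
  · intro s hs t ht
    have := hL.dist_le_mul s hs t ht
    simpa [Real.dist_eq, fplus] using this

lemma height (p : Param) (hp : p ∈ domD) (t : ℝ) (h : 5 * (t - p.1 0) ^ 2 ≤ 4 * p.2 ^ 2) :
    (fplus p t - p.1 1) ^ 2 = p.2 ^ 2 - (t - p.1 0) ^ 2 ∧ 1 / 5 ≤ fplus p t - p.1 1 := by
  have hr := hp.2.1
  have e : fplus p t - p.1 1 = Real.sqrt (p.2 ^ 2 - (t - p.1 0) ^ 2) := by simp [fplus]
  rw [e]
  refine ⟨Real.sq_sqrt (by nlinarith), Real.le_sqrt_of_sq_le (by nlinarith)⟩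

lemma final_bd (δ ρ r h y x : ℝ) (hδ : 0 < δ) (hδ' : δ ≤ 1 / 200) (hr : 1 / 2 ≤ r) (hr2 : r ≤ 1)
    (hρ0 : 0 ≤ ρ) (h1 : ρ ≤ r + δ) (h2 : r ≤ ρ + δ) (q1 : h ^ 2 = r ^ 2 - x ^ 2) (q2 : 1 / 5 ≤ h)
    (hy0 : 0 ≤ y) (hρ : ρ ^ 2 = x ^ 2 + y ^ 2) : |y - h| ≤ 20 * δ := by
  have hm : (y - h) * (y + h) = ρ ^ 2 - r ^ 2 := by linear_combination -q1 - hρ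
  have b1 : ρ ^ 2 - r ^ 2 ≤ 3 * δ := by nlinarith
  have b2 : -(3 * δ) ≤ ρ ^ 2 - r ^ 2 := by nlinarith
  rw [abs_le]
  constructor
  · by_contra! hc
    nlinarith
  · by_contra! hc
    nlinarith

lemma near_graph (δ σ : ℝ) (hδ : 0 < δ) (hδσ : δ ≤ σ) (hσ : σ ≤ 1 / 200) (p : Param) (hp : p ∈ domD)
    (v : Plane) (hv : v ∈ circ p) (I : Set ℝ)
    (hS : connectedComponentIn (pr1 ⁻¹' I ∩ circ p) v ⊆ Splus p)
    (hR : pr1 '' rect δ σ p v ⊆ I)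
    (hs : ∀ t ∈ I, 5 * (t - p.1 0) ^ 2 ≤ 4 * p.2 ^ 2) (w : Plane) (hw : w ∈ rect δ σ p v) :
    |w 1 - fplus p (w 0)| ≤ 20 * δ := by
  have hr1 := hp.2.1
  have hr2 := hp.2.2
  have hvI : v 0 ∈ I := by
    have := shift_mem δ σ 0 hδ hδσ (by simpa using hδ.le) p v hv
    exact hR (by simpa using this)
  have hvS : v ∈ Splus p := hS (mem_connectedComponentIn ⟨hvI, hv⟩)
  obtain ⟨θ, -, hθ⟩ := hvS
  have hv0 : v 0 = θ := by rw [hθ, mk2_zero]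
  have hv1 : v 1 = fplus p (v 0) := by rw [hv0, hθ, mk2_one]
  have hh := (height p hp _ (hs _ hvI)).2
  rw [← hv1] at hh
  obtain ⟨ha, hb⟩ := hw
  have hb' : dist w v ≤ σ := hb
  have hw1 : |w 1 - v 1| ≤ σ := by
    apply abs_le_of_sq_le_sq _ (by linarith)
    have := dist_sq2 w v
    nlinarith [sq_nonneg (w 0 - v 0), dist_nonneg (x := w) (y := v)]
  have hw1' := (abs_le.mp hw1).1
  have hwI : w 0 ∈ I := hR ⟨w, ⟨ha, hb⟩, rfl⟩
  obtain ⟨q1, q2⟩ := height p hp _ (hs _ hwI)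
  have hcomp : IsCompact (circ p) := isCompact_sphere _ _
  obtain ⟨u, hu, hud⟩ := hcomp.exists_infDist_eq_dist ⟨v, hv⟩ w
  have hud' : dist w u ≤ δ := by rw [← hud]; exact ha
  have hu' : dist u p.1 = p.2 := hu
  have t1 := dist_triangle w u p.1
  have t2 := dist_triangle u w p.1
  rw [dist_comm u w] at t2
  have hρ := dist_sq2 w p.1
  have e : w 1 - fplus p (w 0) = (w 1 - p.1 1) - (fplus p (w 0) - p.1 1) := by ring
  rw [e]
  exact final_bd δ (dist w p.1) p.2 (fplus p (w 0) - p.1 1) (w 1 - p.1 1) (w 0 - p.1 0) hδ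
    (by linarith) hr1 hr2 dist_nonneg (by linarith) (by linarith) q1 q2 (by linarith) hρ

theorem incomparable_graph_separation :
    ∀ δ σ : ℝ, 0 < δ → δ ≤ σ → σ ≤ 1 / 200 →
    ∀ p p' : Param, p ∈ domD → p' ∈ domD →
    ∀ v v' : Plane, v ∈ circ p → v' ∈ circ p' →
    ¬ Comp δ σ 100 (p, v) (p', v') →
    ∀ I : Set ℝ, (∃ a b : ℝ, I = Set.Icc a b) →
      connectedComponentIn (pr1 ⁻¹' I ∩ circ p) v ⊆ Splus p →
      connectedComponentIn (pr1 ⁻¹' I ∩ circ p') v' ⊆ Splus p' →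
      pr1 '' rect δ σ p v ⊆ I → pr1 '' rect δ σ p' v' ⊆ I →
      LipschitzOnWith 2 (fplus p) I → LipschitzOnWith 2 (fplus p') I →
      (rect δ σ p v ∩ rect δ σ p' v').Nonempty →
      ∃ θ ∈ pr1 '' (rect δ σ p v ∪ rect δ σ p' v'),
        20 * δ < |fplus p θ - fplus p' θ| := by
  intro δ σ hδ hδσ hσ p p' hp hp' v v' hv hv' hC I hI hS hS' hR hR' hL hL' hne
  by_contra! hcon
  apply hC
  have hIo : I.OrdConnected := by
    obtain ⟨a, b, rfl⟩ := hI
    exact Set.ordConnected_Icc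
  have s1 := slope_bd δ σ hδ hδσ hσ p hp v hv I hIo hR hL
  have s2 := slope_bd δ σ hδ hδσ hσ p' hp' v' hv' I hIo hR' hL'
  refine ⟨(p, v), ⟨hp, hv⟩, ?_⟩
  rintro w (hw | hw)
  · obtain ⟨ha, hb⟩ := hw
    have ha' : Metric.infDist w (circ p) ≤ δ := ha
    have hb' : dist w v ≤ σ := hb
    refine ⟨?_, ?_⟩
    · change Metric.infDist w (circ p) ≤ 100 * δ
      linarith
    · change dist w v ≤ 100 * σ
      linarith
  · have hn := near_graph δ σ hδ hδσ hσ p' hp' v' hv' I hS' hR' s2 w hw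
    have hc := hcon (w 0) ⟨w, Or.inr hw, rfl⟩
    have hwI : w 0 ∈ I := hR' ⟨w, hw, rfl⟩
    obtain ⟨q1, q2⟩ := height p hp _ (s1 _ hwI)
    have hr1 := hp.2.1
    refine ⟨?_, ?_⟩
    · change Metric.infDist w (circ p) ≤ 100 * δ
      have hm : mk2 (w 0) (fplus p (w 0)) ∈ circ p := by
        change dist _ _ = _
        have := dist_sq2 (mk2 (w 0) (fplus p (w 0))) p.1
        rw [mk2_zero, mk2_one] at this
        exact (pow_left_inj₀ dist_nonneg (by linarith) two_ne_zero).mp (by linarith)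
      refine (Metric.infDist_le_dist_of_mem hm).trans ?_
      have hb : |w 1 - fplus p (w 0)| ≤ 40 * δ := by
        rw [abs_le] at *
        constructor <;> linarith [hn.1, hn.2, hc.1, hc.2]
      have := dist_sq2 w (mk2 (w 0) (fplus p (w 0)))
      rw [mk2_zero, mk2_one] at this
      apply abs_le_of_sq_le_sq _ (by linarith) |> le_trans (le_abs_self _)
      rw [this]
      have := sq_le_sq' (by linarith [abs_nonneg (w 1 - fplus p (w 0))]) hb
      rw [sq_abs] at this
      nlinarith
    · change dist w v ≤ 100 * σ
      obtain ⟨z, ⟨-, hz⟩, ⟨-, hz'⟩⟩ := hne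
      have h1 : dist z v ≤ σ := hz
      have h2 : dist z v' ≤ σ := hz'
      have h3 : dist w v' ≤ σ := hw.2
      have t1 := dist_triangle w v' v
      have t2 := dist_triangle v' z v
      rw [dist_comm v' z] at t2
      linarith

end
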